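/- Assume the standing conditions on H, f, m₀, u_T, and let m̄ ∈ L^{α+1}(Q) be nonnegative. Then the convexified energy Ē is convex on K, and strictly convex with respect to m in the quantitative sense: for all τ ∈ [0,1] and all (m,w), (μ,v) ∈ K, Ē(τm + (1−τ)μ, τw + (1−τ)v) ≤ τ Ē(m,w) + (1−τ) Ē(μ,v) − (1/2) τ(1−τ) ∫_Q min{(m+1)^{α−1}, (μ+1)^{α−1}} (m−μ)² dx dt. -/

import Mathlib

open MeasureTheory Set Filter Topology

noncomputable section

/-- Points of `ℝ^N`.  `ℤ^N`-periodic functions on `RN N` model functions on the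
flat torus `T^N`. -/
abbrev RN (N : ℕ) := Fin N → ℝ

/-- The Euclidean norm on `ℝ^N`. -/
def euclNorm {N : ℕ} (p : RN N) : ℝ := Real.sqrt (∑ i, p i ^ 2)

/-- The Euclidean inner product on `ℝ^N`. -/
def dotp {N : ℕ} (p q : RN N) : ℝ := ∑ i, p i * q i

/-- `ℤ^N`-periodicity: such functions are exactly the functions on the flat torus `T^N`. -/
def ZPeriodic {N : ℕ} {β : Type*} (u : RN N → β) : Prop :=
  ∀ (x : RN N) (z : Fin N → ℤ), u (fun i => x i + (z i : ℝ)) = u x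

/-- Partial derivative in the `i`-th coordinate direction. -/
def pd {N : ℕ} (i : Fin N) (u : RN N → ℝ) (x : RN N) : ℝ := fderiv ℝ u x (Pi.single i 1)

/-- Spatial gradient. -/
def grad {N : ℕ} (u : RN N → ℝ) (x : RN N) : RN N := fun i => pd i u x

/-- Divergence of a vector field. -/
def dive {N : ℕ} (w : RN N → RN N) (x : RN N) : ℝ := ∑ i, pd i (fun y => w y i) x

/-- Laplacian. -/
def lap {N : ℕ} (u : RN N → ℝ) (x : RN N) : ℝ := ∑ i, pd i (pd i u) x

/-- The unit cube, a fundamental domain for the torus `T^N` (of total measure `1`,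
so that the measure on the torus is the normalized one). -/
def cube (N : ℕ) : Set (RN N) := Set.Icc 0 1

/-- The space-time cylinder `Q = T^N × (0,T)`. -/
def QQ (N : ℕ) (T : ℝ) : Set (RN N × ℝ) := cube N ×ˢ Ioo 0 T

/-- Integral over `Q = T^N × (0,T)`. -/
def intQ (N : ℕ) (T : ℝ) (f : RN N → ℝ → ℝ) : ℝ := ∫ q in QQ N T, f q.1 q.2

/-- Smooth space-periodic test functions on `T^N × [0,T]`. -/
def IsTest (N : ℕ) (φ : RN N → ℝ → ℝ) : Prop :=
  ContDiff ℝ (⊤ : ℕ∞) (fun q : RN N × ℝ => φ q.1 q.2) ∧ ∀ t, ZPeriodic fun x => φ x t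

/-- The Legendre transform `L(q) = sup_p (p·q - H(p))`. -/
def Leg {N : ℕ} (H : RN N → ℝ) (q : RN N) : ℝ := sSup ((fun p => dotp p q - H p) '' Set.univ)

/-- `m L(-w/m)`, with the convention that it vanishes when `m ≤ 0` (recall that in `K`
one has `w = 0` a.e. on `{m = 0}`). -/
def mLag {N : ℕ} (L : RN N → ℝ) (mv : ℝ) (wv : RN N) : ℝ :=
  if 0 < mv then mv * L ((-mv⁻¹) • wv) else 0

/-- `|w|^{γ'} m^{1-γ'}`, with the convention that it vanishes when `m ≤ 0`. -/
def kinQ {N : ℕ} (γ' : ℝ) (mv : ℝ) (wv : RN N) : ℝ :=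
  if 0 < mv then euclNorm wv ^ γ' * mv ^ (1 - γ') else 0

/-- `F(x,m) = ∫_0^m f(x,σ) dσ`. -/
def Fint {N : ℕ} (f : RN N → ℝ → ℝ) (x : RN N) (mv : ℝ) : ℝ := ∫ σ in (0:ℝ)..mv, f x σ

/-- The convexifying term `G(x,t,m)`, as a function of `m̄(x,t)` (argument `mb`) and `m`. -/
def Gcvx (c_f α mb mv : ℝ) : ℝ :=
  ((c_f + 1) / (α * (α + 1))) * ((mv + 1) ^ (α + 1) - (mb + 1) ^ (α + 1))
    - ((c_f + 1) / α) * (mb + 1) ^ α * (mv - mb)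

/-- `g = ∂_m G`, as a function of `m̄(x,t)` (argument `mb`) and `m`. -/
def gcvx (c_f α mb mv : ℝ) : ℝ := ((c_f + 1) / α) * ((mv + 1) ^ α - (mb + 1) ^ α)

/-- The penalised Lagrangian `L_η(q) = L(q) + (η/(N+3)) |q|^{N+3}`. -/
def Lpen {N : ℕ} (L : RN N → ℝ) (η : ℝ) (q : RN N) : ℝ :=
  L q + (η / ((N : ℝ) + 3)) * euclNorm q ^ ((N : ℝ) + 3)

/-- The penalised Hamiltonian `H_η`, the Legendre transform of `L_η`. -/
def Hpen {N : ℕ} (L : RN N → ℝ) (η : ℝ) : RN N → ℝ := Leg (Lpen L η)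

/-- `g` is the weak spatial gradient of `m` on `Q`. -/
def HasWeakGradQ (N : ℕ) (T : ℝ) (m : RN N → ℝ → ℝ) (g : RN N → ℝ → RN N) : Prop :=
  ∀ Φ : RN N → ℝ → RN N, ContDiff ℝ (⊤ : ℕ∞) (fun q : RN N × ℝ => Φ q.1 q.2) →
    (∀ t, ZPeriodic fun x => Φ x t) →
    intQ N T (fun x t => m x t * dive (fun y => Φ y t) x)
      = -intQ N T (fun x t => dotp (g x t) (Φ x t))

/-- `m` is `θ`-Hölder continuous on `T^N × [0,T]` with constant `C`. -/
def HolderOnQ (N : ℕ) (T C θ : ℝ) (m : RN N → ℝ → ℝ) : Prop :=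
  ∀ x t x' t', t ∈ Icc (0:ℝ) T → t' ∈ Icc (0:ℝ) T →
    |m x t - m x' t'| ≤
      C * Real.sqrt (euclNorm (fun i => x i - x' i) ^ 2 + (t - t') ^ 2) ^ θ

/-- Membership in the constraint set `K`: `(m,w) ∈ L^{α+1}(Q) × L¹(Q;ℝ^N)`, `m ≥ 0`,
`|w|^{γ'} m^{1-γ'} ∈ L¹(Q)`, together with the weak Fokker–Planck constraint
(with initial datum `m₀`); the field `traceId` states that `m(·,T)` is the time-`T`
trace of `m` determined by the constraint. -/
structure MemK (N : ℕ) (T α γ' : ℝ) (m₀ : RN N → ℝ)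
    (m : RN N → ℝ → ℝ) (w : RN N → ℝ → RN N) : Prop where
  per_m : ∀ t, ZPeriodic fun x => m x t
  per_w : ∀ t, ZPeriodic fun x => w x t
  nonneg : ∀ x t, 0 ≤ m x t
  lp_m : IntegrableOn (fun q : RN N × ℝ => m q.1 q.2 ^ (α + 1)) (QQ N T)
  l1_w : IntegrableOn (fun q : RN N × ℝ => w q.1 q.2) (QQ N T)
  vanish : ∀ᵐ q ∂(volume.restrict (QQ N T)), m q.1 q.2 = 0 → w q.1 q.2 = 0
  kin_int : IntegrableOn (fun q : RN N × ℝ => kinQ γ' (m q.1 q.2) (w q.1 q.2)) (QQ N T)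
  traceInt : IntegrableOn (fun x => m x T) (cube N)
  fp : ∀ φ : RN N → ℝ → ℝ, IsTest N φ → (∀ x, φ x T = 0) →
    intQ N T (fun x t => m x t * deriv (φ x) t + dotp (w x t) (grad (fun y => φ y t) x)
        + m x t * lap (fun y => φ y t) x)
      + (∫ x in cube N, m₀ x * φ x 0) = 0
  traceId : ∀ φ : RN N → ℝ → ℝ, IsTest N φ →
    intQ N T (fun x t => m x t * deriv (φ x) t + dotp (w x t) (grad (fun y => φ y t) x)
        + m x t * lap (fun y => φ y t) x)
      + (∫ x in cube N, m₀ x * φ x 0) - (∫ x in cube N, m x T * φ x T) = 0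

/-- The energy functional `E` on `K`, with Lagrangian `L` and coupling antiderivative `F`. -/
def energyF (N : ℕ) (T : ℝ) (L : RN N → ℝ) (F : RN N → ℝ → ℝ) (uT : RN N → ℝ)
    (m : RN N → ℝ → ℝ) (w : RN N → ℝ → RN N) : ℝ :=
  intQ N T (fun x t => mLag L (m x t) (w x t) - F x (m x t)) + ∫ x in cube N, uT x * m x T

/-- `(m,w)` belongs to `K` and minimises the energy over `K`. -/
def MinimisesE (N : ℕ) (T α γ' : ℝ) (m₀ : RN N → ℝ) (L : RN N → ℝ) (F : RN N → ℝ → ℝ)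
    (uT : RN N → ℝ) (m : RN N → ℝ → ℝ) (w : RN N → ℝ → RN N) : Prop :=
  MemK N T α γ' m₀ m w ∧
    ∀ m' w', MemK N T α γ' m₀ m' w' → energyF N T L F uT m w ≤ energyF N T L F uT m' w'

/-- Classical solution of the MFG system `-∂_t u - Δu + H(∇u) = fc(x,t,m)`,
`∂_t m - Δm - div(∇H(∇u) m) = 0`, `m(·,0) = m₀`, `u(·,T) = u_T`:
`u, m` are continuous on `T^N × [0,T]` together with `∂_t u, ∂_t m` and all first and
second space derivatives, and the equations hold pointwise. -/
structure ClassicalSol (N : ℕ) (T : ℝ) (H : RN N → ℝ) (fc : RN N → ℝ → ℝ → ℝ)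
    (m₀ uT : RN N → ℝ) (u m : RN N → ℝ → ℝ) : Prop where
  per_u : ∀ t, ZPeriodic fun x => u x t
  per_m : ∀ t, ZPeriodic fun x => m x t
  cont_u : ContinuousOn (fun q : RN N × ℝ => u q.1 q.2) ((Set.univ : Set (RN N)) ×ˢ Icc 0 T)
  cont_m : ContinuousOn (fun q : RN N × ℝ => m q.1 q.2) ((Set.univ : Set (RN N)) ×ˢ Icc 0 T)
  cont_ut : ContinuousOn (fun q : RN N × ℝ => deriv (u q.1) q.2)
    ((Set.univ : Set (RN N)) ×ˢ Icc 0 T)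
  cont_mt : ContinuousOn (fun q : RN N × ℝ => deriv (m q.1) q.2)
    ((Set.univ : Set (RN N)) ×ˢ Icc 0 T)
  cont_du : ∀ i, ContinuousOn (fun q : RN N × ℝ => pd i (fun y => u y q.2) q.1)
    ((Set.univ : Set (RN N)) ×ˢ Icc 0 T)
  cont_dm : ∀ i, ContinuousOn (fun q : RN N × ℝ => pd i (fun y => m y q.2) q.1)
    ((Set.univ : Set (RN N)) ×ˢ Icc 0 T)
  cont_ddu : ∀ i j, ContinuousOn (fun q : RN N × ℝ => pd i (pd j fun y => u y q.2) q.1)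
    ((Set.univ : Set (RN N)) ×ˢ Icc 0 T)
  cont_ddm : ∀ i j, ContinuousOn (fun q : RN N × ℝ => pd i (pd j fun y => m y q.2) q.1)
    ((Set.univ : Set (RN N)) ×ˢ Icc 0 T)
  tdiff_u : ∀ x, ∀ t ∈ Ioo 0 T, DifferentiableAt ℝ (u x) t
  tdiff_m : ∀ x, ∀ t ∈ Ioo 0 T, DifferentiableAt ℝ (m x) t
  xdiff_u : ∀ t ∈ Icc 0 T,
    Differentiable ℝ (fun y => u y t) ∧ ∀ i, Differentiable ℝ (pd i fun y => u y t)
  xdiff_m : ∀ t ∈ Icc 0 T,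
    Differentiable ℝ (fun y => m y t) ∧ ∀ i, Differentiable ℝ (pd i fun y => m y t)
  hjb : ∀ x, ∀ t ∈ Ioo 0 T,
    -deriv (u x) t - lap (fun y => u y t) x + H (grad (fun y => u y t) x) = fc x t (m x t)
  fkp : ∀ x, ∀ t ∈ Ioo 0 T,
    deriv (m x) t - lap (fun y => m y t) x
      - dive (fun y => m y t • grad H (grad (fun z => u z t) y)) x = 0
  init : ∀ x, m x 0 = m₀ x
  final : ∀ x, u x T = uT x

/-- Weak solution `(u,m)` (with weak spatial gradient `Du` of `u`) of the MFG system
`-∂_t u - Δu + H(∇u) = fc(x,t,m)`, `∂_t m - Δm - div(∇H(∇u) m) = 0`, `m(·,0) = m₀`,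
`u(·,T) = u_T`, in the sense of Definition 3.1 of the paper. -/
structure WeakSol (N : ℕ) (T γ α : ℝ) (H : RN N → ℝ) (fc : RN N → ℝ → ℝ → ℝ)
    (m₀ uT : RN N → ℝ) (u m : RN N → ℝ → ℝ) (Du : RN N → ℝ → RN N) : Prop where
  per_u : ∀ t, ZPeriodic fun x => u x t
  per_m : ∀ t, ZPeriodic fun x => m x t
  per_Du : ∀ t, ZPeriodic fun x => Du x t
  nonneg_m : ∀ x t, 0 ≤ m x t
  lp_m : IntegrableOn (fun q : RN N × ℝ => m q.1 q.2 ^ (α + 1)) (QQ N T)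
  lq_u_sup : α < γ / N → ∃ C, ∀ᵐ q ∂(volume.restrict (QQ N T)), |u q.1 q.2| ≤ C
  lq_u_int : γ / N < α →
    IntegrableOn (fun q : RN N × ℝ =>
      |u q.1 q.2| ^ (γ * (α + 1) * (1 + (N : ℝ)) / (α * N - γ))) (QQ N T)
  weak_grad : HasWeakGradQ N T u Du
  lγ_Du : IntegrableOn (fun q : RN N × ℝ => euclNorm (Du q.1 q.2) ^ γ) (QQ N T)
  int_mL : IntegrableOn (fun q : RN N × ℝ =>
      m q.1 q.2 * Leg H (grad H (Du q.1 q.2))) (QQ N T)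
  int_mDH : IntegrableOn (fun q : RN N × ℝ => m q.1 q.2 • grad H (Du q.1 q.2)) (QQ N T)
  hjb : ∀ φ : RN N → ℝ → ℝ, IsTest N φ → (∀ x t, 0 ≤ φ x t) →
    (∃ ε > (0:ℝ), ∀ x, ∀ t ≤ ε, φ x t = 0) →
    intQ N T (fun x t => u x t * deriv (φ x) t - u x t * lap (fun y => φ y t) x
        + (H (Du x t) - fc x t (m x t)) * φ x t)
      ≤ ∫ x in cube N, uT x * φ x T
  fkp : ∀ φ : RN N → ℝ → ℝ, IsTest N φ → (∀ x, φ x T = 0) →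
    intQ N T (fun x t => m x t * deriv (φ x) t
        - dotp (m x t • grad H (Du x t)) (grad (fun y => φ y t) x)
        + m x t * lap (fun y => φ y t) x)
      + (∫ x in cube N, m₀ x * φ x 0) = 0
  energy_id : intQ N T (fun x t =>
        m x t * (-(fc x t (m x t)) + Leg H (grad H (Du x t))))
      + (∫ x in cube N, (m x T * uT x - m₀ x * u x 0)) = 0

/-- Nonnegative weak solution of the Fokker–Planck equation
`∂_t m - Δm + div(A m) = 0` in `Q`, `m(·,0) = m₀`, with finite energy
`E = ∫_Q |A|^{γ'} m < ∞`. -/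
structure FPSol (N : ℕ) (T γ' : ℝ) (m₀ : RN N → ℝ) (m : RN N → ℝ → ℝ)
    (A : RN N → ℝ → RN N) : Prop where
  per_m : ∀ t, ZPeriodic fun x => m x t
  per_A : ∀ t, ZPeriodic fun x => A x t
  nonneg : ∀ x t, 0 ≤ m x t
  int_m : IntegrableOn (fun q : RN N × ℝ => m q.1 q.2) (QQ N T)
  int_E : IntegrableOn (fun q : RN N × ℝ => euclNorm (A q.1 q.2) ^ γ' * m q.1 q.2) (QQ N T)
  weak : ∀ φ : RN N → ℝ → ℝ, IsTest N φ → (∀ x, φ x T = 0) →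
    intQ N T (fun x t => m x t * (deriv (φ x) t + lap (fun y => φ y t) x
        + dotp (A x t) (grad (fun y => φ y t) x)))
      + (∫ x in cube N, m₀ x * φ x 0) = 0

/-- Conditions on the initial datum of the Fokker–Planck equation: a periodic (i.e.
defined on the torus) Lipschitz probability density, with `‖∇m₀‖_∞ ≤ K₀`. -/
def FPData (N : ℕ) (K₀ : ℝ) (m₀ : RN N → ℝ) : Prop :=
  ZPeriodic m₀ ∧ (∀ x, 0 ≤ m₀ x) ∧ (∫ x in cube N, m₀ x) = 1 ∧
    Differentiable ℝ m₀ ∧ ∀ x, euclNorm (grad m₀ x) ≤ K₀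

/-- Cauchy–Schwarz for `dotp` and `euclNorm`. -/
lemma dotp_le_euclNorm_mul {N : ℕ} (p q : RN N) : dotp p q ≤ euclNorm p * euclNorm q :=
  Real.sum_mul_le_sqrt_mul_sqrt _ _ _

lemma euclNorm_nonneg {N : ℕ} (p : RN N) : 0 ≤ euclNorm p := Real.sqrt_nonneg _

lemma euclNorm_smul {N : ℕ} (c : ℝ) (p : RN N) : euclNorm (c • p) = |c| * euclNorm p := by
  simp only [euclNorm, Pi.smul_apply, smul_eq_mul, mul_pow]
  rw [← Finset.mul_sum, Real.sqrt_mul (sq_nonneg c), Real.sqrt_sq_eq_abs]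

/-- A superlinear lower bound on `H` makes its Legendre transform finite. -/
lemma bddAbove_legendre {N : ℕ} {γ C : ℝ} (hγ : 1 < γ) (hC : 0 < C) {H : RN N → ℝ}
    (hH : ∀ p, C⁻¹ * euclNorm p ^ γ ≤ H p) (q : RN N) :
    BddAbove ((fun p => dotp p q - H p) '' Set.univ) := by
  have hq := euclNorm_nonneg q
  have hγ0 : 0 < γ - 1 := by linarith
  set R := (C * euclNorm q) ^ (1 / (γ - 1)) with hR
  have hR0 : 0 ≤ R := by positivity
  refine ⟨R * euclNorm q, ?_⟩
  rintro _ ⟨p, -, rfl⟩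
  have hp := euclNorm_nonneg p
  have h1 := dotp_le_euclNorm_mul p q
  have h2 := hH p
  have h3 : 0 ≤ C⁻¹ * euclNorm p ^ γ := by positivity
  rcases le_total (euclNorm p) R with h | h
  · have := mul_le_mul_of_nonneg_right h hq
    dsimp only
    linarith
  · have h4 : C * euclNorm q ≤ euclNorm p ^ (γ - 1) := by
      calc C * euclNorm q = R ^ (γ - 1) := by
            rw [hR, ← Real.rpow_mul (by positivity), one_div, inv_mul_cancel₀ hγ0.ne',
              Real.rpow_one]
        _ ≤ _ := by gcongr
    have h5 : euclNorm p ^ γ = euclNorm p * euclNorm p ^ (γ - 1) := by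
      rcases hp.eq_or_lt with h0 | h0
      · rw [← h0, Real.zero_rpow (by linarith), zero_mul]
      · rw [← Real.rpow_one_add' hp (by linarith)]
        congr 1
        ring
    have h6 : euclNorm p * euclNorm q ≤ C⁻¹ * euclNorm p ^ γ := by
      rw [h5, ← div_eq_inv_mul, le_div_iff₀ hC]
      nlinarith [mul_le_mul_of_nonneg_left h4 hp]
    have : 0 ≤ R * euclNorm q := by positivity
    dsimp only
    linarith

/-- A finite Legendre transform is convex. -/
lemma convexOn_legendre {N : ℕ} {H : RN N → ℝ}
    (hb : ∀ q, BddAbove ((fun p => dotp p q - H p) '' Set.univ)) :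
    ConvexOn ℝ Set.univ (Leg H) := by
  refine ⟨convex_univ, fun q₁ _ q₂ _ a b ha hb' hab => ?_⟩
  refine csSup_le (Set.univ_nonempty.image _) ?_
  rintro _ ⟨p, -, rfl⟩
  have h1 : dotp p q₁ - H p ≤ Leg H q₁ := le_csSup (hb q₁) ⟨p, trivial, rfl⟩
  have h2 : dotp p q₂ - H p ≤ Leg H q₂ := le_csSup (hb q₂) ⟨p, trivial, rfl⟩
  have h3 : dotp p (a • q₁ + b • q₂) = a * dotp p q₁ + b * dotp p q₂ := by
    simp only [dotp, Pi.add_apply, Pi.smul_apply, smul_eq_mul, Finset.mul_sum,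
      ← Finset.sum_add_distrib]
    exact Finset.sum_congr rfl fun i _ => by ring
  have h4 : H p = a * H p + b * H p := by rw [← add_mul, hab, one_mul]
  simp only [smul_eq_mul]
  rw [h3, h4]
  nlinarith [mul_le_mul_of_nonneg_left h1 ha, mul_le_mul_of_nonneg_left h2 hb']

lemma mLag_zero {N : ℕ} (L : RN N → ℝ) (w : RN N) : mLag L 0 w = 0 := by simp [mLag]

/-- The perspective `(m, w) ↦ m L(-w/m)` of a convex function is jointly convex. -/
lemma mLag_convex {N : ℕ} {L : RN N → ℝ} (hL : ConvexOn ℝ Set.univ L) {a b : ℝ}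
    {w v : RN N} (ha : 0 ≤ a) (hb : 0 ≤ b) (hw : a = 0 → w = 0) (hv : b = 0 → v = 0)
    {s t : ℝ} (hs : 0 ≤ s) (ht : 0 ≤ t) :
    mLag L (s * a + t * b) (s • w + t • v) ≤ s * mLag L a w + t * mLag L b v := by
  have scale : ∀ (s a : ℝ) (w : RN N), 0 ≤ s → 0 ≤ a →
      mLag L (s * a) (s • w) = s * mLag L a w := by
    intro s a w hs ha
    rcases hs.eq_or_lt with rfl | hs
    · simp [mLag]
    rcases ha.eq_or_lt with rfl | ha
    · simp [mLag]
    have : (-(s * a)⁻¹) • s • w = (-a⁻¹) • w := by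
      rw [smul_smul]; congr 1; field_simp
    rw [mLag, mLag, if_pos ha, if_pos (mul_pos hs ha), this, mul_assoc]
  rw [← scale s a w hs ha, ← scale t b v ht hb]
  have hsw : s * a = 0 → s • w = 0 := fun h => by
    rcases mul_eq_zero.1 h with h | h
    · simp [h]
    · simp [hw h]
  have htv : t * b = 0 → t • v = 0 := fun h => by
    rcases mul_eq_zero.1 h with h | h
    · simp [h]
    · simp [hv h]
  have hA := mul_nonneg hs ha
  have hB := mul_nonneg ht hb
  generalize s * a = A at *
  generalize t * b = B at *
  generalize s • w = W at *
  generalize t • v = V at *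
  rcases hA.eq_or_lt with rfl | hA
  · simp [hsw rfl, mLag_zero]
  rcases hB.eq_or_lt with rfl | hB
  · simp [htv rfl, mLag_zero]
  have hAB : 0 < A + B := by positivity
  have key := hL.2 (Set.mem_univ ((-A⁻¹) • W)) (Set.mem_univ ((-B⁻¹) • V))
    (show 0 ≤ A / (A + B) by positivity) (show 0 ≤ B / (A + B) by positivity) (by field_simp)
  have harg : (A / (A + B)) • ((-A⁻¹) • W) + (B / (A + B)) • ((-B⁻¹) • V)
      = (-(A + B)⁻¹) • (W + V) := by
    rw [smul_smul, smul_smul, smul_add]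
    congr 2 <;> field_simp
  rw [harg, smul_eq_mul, smul_eq_mul] at key
  rw [mLag, mLag, mLag, if_pos hA, if_pos hB, if_pos hAB]
  calc (A + B) * L ((-(A + B)⁻¹) • (W + V))
      ≤ (A + B) * (A / (A + B) * L ((-A⁻¹) • W) + B / (A + B) * L ((-B⁻¹) • V)) := by gcongr
    _ = _ := by field_simp

lemma measurable_mLag {N : ℕ} {L : RN N → ℝ} (hL : Measurable L) :
    Measurable fun z : ℝ × RN N => mLag L z.1 z.2 := by
  unfold mLag
  refine Measurable.ite (measurableSet_lt measurable_const measurable_fst) ?_ measurable_const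
  exact measurable_fst.mul (hL.comp (measurable_fst.inv.neg.smul measurable_snd))

lemma neg_mul_le_mLag {N : ℕ} {L : RN N → ℝ} {C a : ℝ} (hL : ∀ q, -C ≤ L q) (ha : 0 ≤ a)
    (w : RN N) : -(C * a) ≤ mLag L a w := by
  rcases ha.eq_or_lt with rfl | ha
  · simp [mLag]
  · rw [mLag, if_pos ha]
    nlinarith [mul_le_mul_of_nonneg_left (hL ((-a⁻¹) • w)) ha.le]

lemma mLag_le {N : ℕ} {L : RN N → ℝ} {C a r : ℝ} (hL : ∀ q, L q ≤ C * (euclNorm q ^ r + 1))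
    (ha : 0 ≤ a) (w : RN N) : mLag L a w ≤ C * (kinQ r a w + a) := by
  rcases ha.eq_or_lt with rfl | ha
  · simp [mLag, kinQ]
  · rw [mLag, kinQ, if_pos ha, if_pos ha]
    have h1 := mul_le_mul_of_nonneg_left (hL ((-a⁻¹) • w)) ha.le
    have h2 : a * euclNorm ((-a⁻¹) • w) ^ r = euclNorm w ^ r * a ^ (1 - r) := by
      rw [euclNorm_smul, abs_neg, abs_of_pos (inv_pos.2 ha),
        Real.mul_rpow (by positivity) (euclNorm_nonneg w), Real.inv_rpow ha.le,
        Real.rpow_sub ha, Real.rpow_one]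
      ring
    rw [← h2]
    linarith
/-- A continuous coupling has an antiderivative jointly continuous on `{s ≥ 0}`: the one of the
coupling extended by its value at `0`. -/
lemma continuous_extended_primitive {N : ℕ} {f : RN N → ℝ → ℝ}
    (hf : ContinuousOn (fun q : RN N × ℝ => f q.1 q.2) (Set.univ ×ˢ Ici (0 : ℝ))) :
    Continuous fun q : RN N × ℝ => ∫ σ in (0 : ℝ)..q.2, f q.1 (max σ 0) := by
  have h : Continuous fun q : RN N × ℝ => f q.1 (max q.2 0) :=
    hf.comp_continuous (f := fun q : RN N × ℝ => (q.1, max q.2 0)) (by fun_prop)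
      fun q => ⟨trivial, mem_Ici.2 (le_max_right _ _)⟩
  have h' : Continuous (Function.uncurry fun (q : RN N × ℝ) (σ : ℝ) => f q.1 (max σ 0)) :=
    h.comp (by fun_prop : Continuous fun z : (RN N × ℝ) × ℝ => (z.1.1, z.2))
  exact intervalIntegral.continuous_parametric_intervalIntegral_of_continuous
    h' continuous_snd

lemma Fint_eq_extended {N : ℕ} (f : RN N → ℝ → ℝ) (x : RN N) {s : ℝ} (hs : 0 ≤ s) :
    Fint f x s = ∫ σ in (0 : ℝ)..s, f x (max σ 0) := by
  refine intervalIntegral.integral_congr fun σ hσ => ?_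
  rw [Set.uIcc_of_le hs] at hσ
  simp only [max_eq_left hσ.1]

/-- Power growth of a coupling whose derivative has power growth. -/
lemma coupling_growth {g g' : ℝ → ℝ} {c α : ℝ} (hα : 0 < α)
    (hg : ∀ s, 0 ≤ s → HasDerivAt g (g' s) s)
    (hb : ∀ s, 0 ≤ s → |g' s| ≤ c * (s + 1) ^ (α - 1)) {s : ℝ} (hs : 0 ≤ s) :
    g s ≤ g 0 + c / α * (s + 1) ^ α := by
  have hc : 0 ≤ c := by simpa using (abs_nonneg _).trans (hb 0 le_rfl)
  have hd : ∀ s, 0 ≤ s → HasDerivAt (fun s => c / α * (s + 1) ^ α - g s)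
      (c * (s + 1) ^ (α - 1) - g' s) s := by
    intro s hs
    have h1 : HasDerivAt (fun s : ℝ => (s + 1) ^ α) (1 * α * (s + 1) ^ (α - 1)) s :=
      ((hasDerivAt_id s).add_const 1).rpow_const (Or.inl (by simp; linarith))
    refine ((h1.const_mul (c / α)).sub (hg s hs)).congr_deriv ?_
    rw [one_mul, ← mul_assoc, div_mul_cancel₀ _ hα.ne']
  have hmono : MonotoneOn (fun s => c / α * (s + 1) ^ α - g s) (Ici 0) := by
    refine monotoneOn_of_hasDerivWithinAt_nonneg (convex_Ici 0)
      (fun s hs => (hd s hs).continuousAt.continuousWithinAt)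
      (fun s hs => (hd s (interior_subset hs)).hasDerivWithinAt) fun s hs => ?_
    have := (le_abs_self _).trans (hb s (interior_subset hs))
    linarith
  have := hmono self_mem_Ici hs hs
  simp only [zero_add, Real.one_rpow, mul_one] at this
  have : 0 ≤ c / α := by positivity
  linarith

/-- Power growth of the antiderivative of the coupling. -/
lemma abs_Fint_le {N : ℕ} {f f' : RN N → ℝ → ℝ} {c α M : ℝ} (hα : 0 < α) {x : RN N}
    (hnn : ∀ s, 0 ≤ s → 0 ≤ f x s)
    (hg : ∀ s, 0 ≤ s → HasDerivAt (f x) (f' x s) s)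
    (hb : ∀ s, 0 ≤ s → |f' x s| ≤ c * (s + 1) ^ (α - 1)) (hM : f x 0 ≤ M)
    {s : ℝ} (hs : 0 ≤ s) :
    |Fint f x s| ≤ (M + c / α) * (s + 1) ^ (α + 1) := by
  have hc : 0 ≤ c := by simpa using (abs_nonneg _).trans (hb 0 le_rfl)
  have hM0 : 0 ≤ M := (hnn 0 le_rfl).trans hM
  have h1s : 1 ≤ (s + 1) ^ α := Real.one_le_rpow (by linarith) hα.le
  have h : ‖Fint f x s‖ ≤ ((M + c / α) * (s + 1) ^ α) * |s - 0| := by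
    refine intervalIntegral.norm_integral_le_of_norm_le_const fun σ hσ => ?_
    rw [Set.uIoc_of_le hs] at hσ
    rw [Real.norm_eq_abs, abs_of_nonneg (hnn σ hσ.1.le)]
    calc f x σ ≤ f x 0 + c / α * (σ + 1) ^ α := coupling_growth hα hg hb hσ.1.le
      _ ≤ M * (s + 1) ^ α + c / α * (s + 1) ^ α := by
        have h0 := hσ.1
        have h2 : (σ + 1) ^ α ≤ (s + 1) ^ α := by
          gcongr
          exact hσ.2
        have h3 : M ≤ M * (s + 1) ^ α := le_mul_of_one_le_right hM0 h1s
        have h4 : c / α * (σ + 1) ^ α ≤ c / α * (s + 1) ^ α := by gcongr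
        linarith
      _ = _ := by ring
  rw [sub_zero, abs_of_nonneg hs, Real.norm_eq_abs] at h
  refine h.trans ?_
  rw [Real.rpow_add_one (by linarith), mul_assoc]
  gcongr
  linarith

/-- The convexifying term compensates the concavity of `-F`, with a quantitative margin. -/
lemma convexOn_Gcvx_sub_primitive {g g' : ℝ → ℝ} {c α b l h k : ℝ} (hα : 0 < α) (hl : 0 ≤ l)
    (hg : ∀ s, 0 ≤ s → HasDerivAt g (g' s) s)
    (hb : ∀ s, 0 ≤ s → |g' s| ≤ c * (s + 1) ^ (α - 1))
    (hk : ∀ s ∈ Icc l h, k ≤ (s + 1) ^ (α - 1)) :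
    ConvexOn ℝ (Icc l h)
      (fun s => Gcvx c α b s - (∫ σ in (0 : ℝ)..s, g (max σ 0)) - k / 2 * s ^ 2) := by
  have hcont : Continuous fun σ => g (max σ 0) := by
    have : ContinuousOn g (Ici 0) := fun s hs => (hg s hs).continuousAt.continuousWithinAt
    exact this.comp_continuous (by fun_prop) fun σ => mem_Ici.2 (le_max_right _ _)
  have hpow : ∀ (r s : ℝ), 0 ≤ s →
      HasDerivAt (fun s : ℝ => (s + 1) ^ r) (r * (s + 1) ^ (r - 1)) s := fun r s hs => by
    simpa using ((hasDerivAt_id s).add_const 1).rpow_const (p := r)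
      (Or.inl (by simp; linarith))
  have hd1 : ∀ s, 0 ≤ s → HasDerivAt
      (fun s => Gcvx c α b s - (∫ σ in (0 : ℝ)..s, g (max σ 0)) - k / 2 * s ^ 2)
      ((c + 1) / α * (s + 1) ^ α - (c + 1) / α * (b + 1) ^ α - g (max s 0) - k * s) s := by
    intro s hs
    have e1 := ((hpow (α + 1) s hs).sub_const ((b + 1) ^ (α + 1))).const_mul
      ((c + 1) / (α * (α + 1)))
    have e2 := ((hasDerivAt_id s).sub_const b).const_mul ((c + 1) / α * (b + 1) ^ α)
    have e3 := intervalIntegral.integral_hasDerivAt_right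
      (hcont.intervalIntegrable 0 s) (hcont.stronglyMeasurableAtFilter _ _) hcont.continuousAt
    have e4 := (hasDerivAt_pow 2 s).const_mul (k / 2)
    refine (((e1.sub e2).sub e3).sub e4).congr_deriv ?_
    rw [add_sub_cancel_right]
    field_simp
    ring
  refine convexOn_of_hasDerivWithinAt2_nonneg (convex_Icc l h)
    (f'' := fun s => (c + 1) * (s + 1) ^ (α - 1) - g' s - k)
    (fun s hs => (hd1 s (hl.trans hs.1)).continuousAt.continuousWithinAt)
    (fun s hs => (hd1 s (hl.trans (interior_subset hs).1)).hasDerivWithinAt) ?_ ?_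
  · intro s hs
    rw [interior_Icc] at hs ⊢
    have hs0 : 0 < s := hl.trans_lt hs.1
    have e := (((((hpow α s hs0.le).const_mul ((c + 1) / α)).sub_const
      ((c + 1) / α * (b + 1) ^ α)).sub (hg s hs0.le)).sub ((hasDerivAt_id s).const_mul k))
    refine (e.congr_of_eventuallyEq ?_).hasDerivWithinAt.congr_deriv ?_
    · filter_upwards [lt_mem_nhds hs0] with y hy
      simp [max_eq_left hy.le]
    · field_simp
  · intro s hs
    have hs' := interior_subset hs
    have h1 := (le_abs_self _).trans (hb s (hl.trans hs'.1))
    have h2 := hk s hs'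
    linarith

lemma min_rpow_le {a b s r : ℝ} (ha : 0 < a) (hb : 0 < b) (hs : s ∈ uIcc a b) :
    min (a ^ r) (b ^ r) ≤ s ^ r := by
  wlog hab : a ≤ b generalizing a b
  · rw [min_comm]
    exact this hb ha (by rwa [uIcc_comm]) (le_of_not_ge hab)
  rw [uIcc_of_le hab] at hs
  rcases le_total 0 r with hr | hr
  · exact (min_le_left _ _).trans (Real.rpow_le_rpow ha.le hs.1 hr)
  · exact (min_le_right _ _).trans
      (Real.rpow_le_rpow_of_nonpos (ha.trans_le hs.1) hs.2 hr)

/-- Pointwise quantitative convexity of `G - F`. -/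
lemma Gcvx_sub_Fint_convex {N : ℕ} {f f' : RN N → ℝ → ℝ} {c α mb : ℝ} (hα : 0 < α) {x : RN N}
    (hg : ∀ s, 0 ≤ s → HasDerivAt (f x) (f' x s) s)
    (hb : ∀ s, 0 ≤ s → |f' x s| ≤ c * (s + 1) ^ (α - 1))
    {a b : ℝ} (ha : 0 ≤ a) (hb0 : 0 ≤ b) {τ : ℝ} (hτ : τ ∈ Icc (0 : ℝ) 1) :
    Gcvx c α mb (τ * a + (1 - τ) * b) - Fint f x (τ * a + (1 - τ) * b)
      ≤ τ * (Gcvx c α mb a - Fint f x a) + (1 - τ) * (Gcvx c α mb b - Fint f x b)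
        - (1 / 2) * τ * (1 - τ) *
          (min ((a + 1) ^ (α - 1)) ((b + 1) ^ (α - 1)) * (a - b) ^ 2) := by
  set k := min ((a + 1) ^ (α - 1)) ((b + 1) ^ (α - 1)) with hk
  have hτ' : 0 ≤ 1 - τ := by linarith [hτ.2]
  have hc0 : 0 ≤ τ * a + (1 - τ) * b := by have := hτ.1; positivity
  have hconv := convexOn_Gcvx_sub_primitive (b := mb) (l := min a b) (h := max a b) (k := k)
    hα (le_min ha hb0) hg hb fun s hs => by
      refine min_rpow_le (by linarith) (by linarith) ?_
      have : s ∈ uIcc a b := hs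
      rcases le_total a b with hab | hab
      · rw [uIcc_of_le hab] at this
        rw [uIcc_of_le (by linarith)]
        exact ⟨by linarith [this.1], by linarith [this.2]⟩
      · rw [uIcc_of_ge hab] at this
        rw [uIcc_of_ge (by linarith)]
        exact ⟨by linarith [this.1], by linarith [this.2]⟩
  have := hconv.2 (left_mem_uIcc : a ∈ uIcc a b) (right_mem_uIcc : b ∈ uIcc a b) hτ.1 hτ'
    (by ring)
  simp only [smul_eq_mul] at this
  rw [← Fint_eq_extended f x hc0, ← Fint_eq_extended f x ha, ← Fint_eq_extended f x hb0] at this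
  nlinarith [this]
lemma add_one_rpow_le {a p : ℝ} (ha : 0 ≤ a) (hp : 0 ≤ p) :
    (a + 1) ^ p ≤ 2 ^ p * (a ^ p + 1) := by
  have h1 : 0 ≤ a ^ p := by positivity
  rcases le_total a 1 with h | h
  · have : (a + 1) ^ p ≤ 2 ^ p := by gcongr; linarith
    nlinarith [Real.rpow_nonneg zero_le_two p]
  · have : (a + 1) ^ p ≤ (2 * a) ^ p := by gcongr; linarith
    rw [Real.mul_rpow zero_le_two ha] at this
    nlinarith [Real.rpow_nonneg zero_le_two p]

lemma rpow_mul_le_add {A B α : ℝ} (hA : 0 ≤ A) (hB : 0 ≤ B) (hα : 0 < α) :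
    A ^ α * B ≤ A ^ (α + 1) + B ^ (α + 1) := by
  have h1 : 0 ≤ A ^ (α + 1) := by positivity
  have h2 : 0 ≤ B ^ (α + 1) := by positivity
  have e : ∀ D : ℝ, 0 ≤ D → D ^ α * D = D ^ (α + 1) := fun D hD =>
    (Real.rpow_add_one' hD (by linarith)).symm
  rcases le_total A B with h | h
  · have : A ^ α * B ≤ B ^ α * B := by gcongr
    rw [e B hB] at this
    linarith
  · have : A ^ α * B ≤ A ^ α * A := by gcongr
    rw [e A hA] at this
    linarith

lemma abs_Gcvx_le {c α a b : ℝ} (hc : 0 ≤ c) (hα : 0 < α) (ha : 0 ≤ a) (hb : 0 ≤ b) :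
    |Gcvx c α b a| ≤ ((c + 1) / (α * (α + 1)) + 2 * ((c + 1) / α)) *
      ((a + 1) ^ (α + 1) + (b + 1) ^ (α + 1)) := by
  have h1 : 0 ≤ (a + 1) ^ (α + 1) := by positivity
  have h2 : 0 ≤ (b + 1) ^ (α + 1) := by positivity
  have hC1 : 0 ≤ (c + 1) / (α * (α + 1)) := by positivity
  have hC2 : 0 ≤ (c + 1) / α := by positivity
  have h3 := rpow_mul_le_add (A := b + 1) (B := a + 1) (by linarith) (by linarith) hα
  have h4 : (b + 1) ^ α * (b + 1) = (b + 1) ^ (α + 1) :=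
    (Real.rpow_add_one' (by linarith) (by linarith)).symm
  have h5 : 0 ≤ (b + 1) ^ α := by positivity
  have h6 : |(b + 1) ^ α * (a - b)| ≤ 2 * ((a + 1) ^ (α + 1) + (b + 1) ^ (α + 1)) := by
    rw [abs_le]
    constructor <;> nlinarith [mul_nonneg h5 ha, mul_nonneg h5 hb]
  have h7 : |(a + 1) ^ (α + 1) - (b + 1) ^ (α + 1)|
      ≤ (a + 1) ^ (α + 1) + (b + 1) ^ (α + 1) := by
    rw [abs_le]; constructor <;> linarith
  unfold Gcvx
  refine (abs_sub _ _).trans ?_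
  rw [abs_mul, mul_assoc ((c + 1) / α), abs_mul ((c + 1) / α), abs_of_nonneg hC1,
    abs_of_nonneg hC2]
  have := mul_le_mul_of_nonneg_left h6 hC2
  have := mul_le_mul_of_nonneg_left h7 hC1
  linarith

lemma min_rpow_mul_sq_le {a b α : ℝ} (ha : 0 ≤ a) (hb : 0 ≤ b) :
    min ((a + 1) ^ (α - 1)) ((b + 1) ^ (α - 1)) * (a - b) ^ 2
      ≤ (a + 1) ^ (α + 1) + (b + 1) ^ (α + 1) := by
  have e : ∀ D : ℝ, 0 < D → D ^ (α - 1) * D ^ 2 = D ^ (α + 1) := fun D hD => by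
    rw [← Real.rpow_natCast D 2, ← Real.rpow_add hD]
    congr 1
    push_cast
    ring
  have hA : 0 < a + 1 := by linarith
  have hB : 0 < b + 1 := by linarith
  have h1 : 0 ≤ (a + 1) ^ (α + 1) := by positivity
  have h2 : 0 ≤ (b + 1) ^ (α + 1) := by positivity
  rcases le_total a b with h | h
  · calc _ ≤ (b + 1) ^ (α - 1) * (b + 1) ^ 2 :=
        mul_le_mul (min_le_right _ _) (by nlinarith) (sq_nonneg _) (by positivity)
      _ ≤ _ := by rw [e _ hB]; linarith
  · calc _ ≤ (a + 1) ^ (α - 1) * (a + 1) ^ 2 :=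
        mul_le_mul (min_le_left _ _) (by nlinarith) (sq_nonneg _) (by positivity)
      _ ≤ _ := by rw [e _ hA]; linarith

section Integrability

variable {X : Type*} [MeasurableSpace X] {ν : Measure X} {α : ℝ} {a b : X → ℝ}

lemma aemeasurable_of_integrable_rpow (hα : 0 < α) (ha : ∀ x, 0 ≤ a x)
    (hint : Integrable (fun x => a x ^ (α + 1)) ν) : AEMeasurable a ν := by
  have h := hint.aestronglyMeasurable.aemeasurable.pow_const (1 / (α + 1))
  convert h using 2 with x
  rw [← Real.rpow_mul (ha x), mul_one_div_cancel (by linarith), Real.rpow_one]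

lemma integrable_add_one_rpow [IsFiniteMeasure ν] (hα : 0 < α) (ha : ∀ x, 0 ≤ a x)
    (hint : Integrable (fun x => a x ^ (α + 1)) ν) :
    Integrable (fun x => (a x + 1) ^ (α + 1)) ν := by
  refine ((hint.add (integrable_const 1)).const_mul (2 ^ (α + 1))).mono'
    (((aemeasurable_of_integrable_rpow hα ha hint).add_const 1).pow_const _).aestronglyMeasurable
    (ae_of_all _ fun x => ?_)
  have := ha x
  rw [Real.norm_eq_abs, abs_of_nonneg (by positivity)]
  exact add_one_rpow_le (ha x) (by linarith)

lemma integrable_of_add_one_rpow (hα : 0 < α) (ha : ∀ x, 0 ≤ a x) (hm : AEMeasurable a ν)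
    (hint : Integrable (fun x => (a x + 1) ^ (α + 1)) ν) : Integrable a ν := by
  refine hint.mono' hm.aestronglyMeasurable (ae_of_all _ fun x => ?_)
  rw [Real.norm_eq_abs, abs_of_nonneg (ha x)]
  have := Real.self_le_rpow_of_one_le (x := a x + 1) (y := α + 1) (by linarith [ha x])
    (by linarith)
  linarith

lemma integrable_convexComb_add_one_rpow (hα : 0 < α) (ha : ∀ x, 0 ≤ a x) (hb : ∀ x, 0 ≤ b x)
    (ham : AEMeasurable a ν) (hbm : AEMeasurable b ν)
    (hai : Integrable (fun x => (a x + 1) ^ (α + 1)) ν)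
    (hbi : Integrable (fun x => (b x + 1) ^ (α + 1)) ν) {τ : ℝ} (hτ : τ ∈ Icc (0 : ℝ) 1) :
    Integrable (fun x => (τ * a x + (1 - τ) * b x + 1) ^ (α + 1)) ν := by
  have hτ0 := hτ.1
  have hτ1 : 0 ≤ 1 - τ := by linarith [hτ.2]
  refine (hai.add hbi).mono' (((((ham.const_mul τ).add (hbm.const_mul (1 - τ))).add_const
    1).pow_const _).aestronglyMeasurable) (ae_of_all _ fun x => ?_)
  have h1 := ha x
  have h2 := hb x
  have h3 : 0 ≤ (a x + 1) ^ (α + 1) := by positivity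
  have h4 : 0 ≤ (b x + 1) ^ (α + 1) := by positivity
  rw [Real.norm_eq_abs, abs_of_nonneg (by positivity), Pi.add_apply]
  rcases le_total (a x) (b x) with h | h
  · have : (τ * a x + (1 - τ) * b x + 1) ^ (α + 1) ≤ (b x + 1) ^ (α + 1) := by
      gcongr
      nlinarith
    linarith
  · have : (τ * a x + (1 - τ) * b x + 1) ^ (α + 1) ≤ (a x + 1) ^ (α + 1) := by
      gcongr
      nlinarith
    linarith

lemma integrable_Gcvx {c : ℝ} (hc : 0 ≤ c) (hα : 0 < α) (ha : ∀ x, 0 ≤ a x)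
    (hb : ∀ x, 0 ≤ b x) (ham : AEMeasurable a ν) (hbm : AEMeasurable b ν)
    (hai : Integrable (fun x => (a x + 1) ^ (α + 1)) ν)
    (hbi : Integrable (fun x => (b x + 1) ^ (α + 1)) ν) :
    Integrable (fun x => Gcvx c α (b x) (a x)) ν := by
  refine ((hai.add hbi).const_mul _).mono' (AEMeasurable.aestronglyMeasurable ?_)
    (ae_of_all _ fun x => abs_Gcvx_le hc hα (ha x) (hb x))
  unfold Gcvx
  fun_prop

lemma integrable_min_rpow_mul_sq (ha : ∀ x, 0 ≤ a x) (hb : ∀ x, 0 ≤ b x)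
    (ham : AEMeasurable a ν) (hbm : AEMeasurable b ν)
    (hai : Integrable (fun x => (a x + 1) ^ (α + 1)) ν)
    (hbi : Integrable (fun x => (b x + 1) ^ (α + 1)) ν) :
    Integrable (fun x => min ((a x + 1) ^ (α - 1)) ((b x + 1) ^ (α - 1)) * (a x - b x) ^ 2)
      ν := by
  refine (hai.add hbi).mono' (AEMeasurable.aestronglyMeasurable (by fun_prop))
    (ae_of_all _ fun x => ?_)
  have := ha x
  have := hb x
  rw [Real.norm_eq_abs, abs_of_nonneg (by positivity)]
  exact min_rpow_mul_sq_le (ha x) (hb x)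

lemma integrable_mLag {N : ℕ} {L : RN N → ℝ} {w : X → RN N} {C r : ℝ} (hL : Measurable L)
    (hlo : ∀ q, -C ≤ L q) (hup : ∀ q, L q ≤ C * (euclNorm q ^ r + 1)) (hC : 0 ≤ C)
    (ha : ∀ x, 0 ≤ a x) (hai : Integrable a ν) (hw : AEMeasurable w ν)
    (hk : Integrable (fun x => kinQ r (a x) (w x)) ν) :
    Integrable (fun x => mLag L (a x) (w x)) ν := by
  refine ((hk.add hai).const_mul C).mono' ((measurable_mLag hL).comp_aemeasurable
    (hai.aestronglyMeasurable.aemeasurable.prodMk hw)).aestronglyMeasurable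
    (ae_of_all _ fun x => ?_)
  have hk0 : 0 ≤ kinQ r (a x) (w x) := by
    unfold kinQ
    have := euclNorm_nonneg (w x)
    have := ha x
    split_ifs <;> positivity
  rw [Real.norm_eq_abs, abs_le]
  refine ⟨?_, mLag_le hup (ha x) (w x)⟩
  have := neg_mul_le_mLag hlo (ha x) (w x)
  simp only [Pi.add_apply]
  nlinarith [mul_nonneg hC hk0]

/-- Integrated form of a quantitative convexity inequality. -/
lemma integral_add_le_of_ae_convex {p p' q q' r r' s : X → ℝ} {τ k : ℝ}
    (hp : Integrable p ν) (hp' : Integrable p' ν) (hq : Integrable q ν) (hq' : Integrable q' ν)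
    (hr : Integrable r ν) (hr' : Integrable r' ν) (hs : Integrable s ν)
    (h : ∀ᵐ x ∂ν, r x + r' x ≤ τ * (p x + p' x) + (1 - τ) * (q x + q' x) - k * s x) :
    (∫ x, r x ∂ν) + ∫ x, r' x ∂ν
      ≤ τ * ((∫ x, p x ∂ν) + ∫ x, p' x ∂ν) + (1 - τ) * ((∫ x, q x ∂ν) + ∫ x, q' x ∂ν)
        - k * ∫ x, s x ∂ν := by
  have hP := (hp.add hp').const_mul τ
  have hQ := (hq.add hq').const_mul (1 - τ)
  have hS := hs.const_mul k
  calc (∫ x, r x ∂ν) + ∫ x, r' x ∂ν = ∫ x, (r x + r' x) ∂ν := (integral_add hr hr').symm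
    _ ≤ ∫ x, (τ * (p x + p' x) + (1 - τ) * (q x + q' x) - k * s x) ∂ν :=
      integral_mono_ae (hr.add hr') ((hP.add hQ).sub hS) h
    _ = ∫ x, (τ * (p x + p' x) + (1 - τ) * (q x + q' x)) ∂ν - ∫ x, k * s x ∂ν :=
      integral_sub (hP.add hQ) hS
    _ = ∫ x, τ * (p x + p' x) ∂ν + ∫ x, (1 - τ) * (q x + q' x) ∂ν - ∫ x, k * s x ∂ν := by
      congr 1
      exact integral_add hP hQ
    _ = _ := by
      rw [integral_const_mul, integral_const_mul, integral_const_mul, integral_add hp hp',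
        integral_add hq hq']

end Integrability

/-- Integrability of the primitive of the coupling along a density. -/
lemma integrable_Fint {N : ℕ} {T : ℝ} {f f' : RN N → ℝ → ℝ} {c α : ℝ} (hα : 0 < α)
    (hf : ContinuousOn (fun q : RN N × ℝ => f q.1 q.2) (Set.univ ×ˢ Ici (0 : ℝ)))
    (hnn : ∀ x s, 0 ≤ s → 0 ≤ f x s)
    (hder : ∀ x s, 0 ≤ s → HasDerivAt (f x) (f' x s) s)
    (hb : ∀ x s, 0 ≤ s → |f' x s| ≤ c * (s + 1) ^ (α - 1))
    {a : RN N × ℝ → ℝ} (ha : ∀ q, 0 ≤ a q) (ham : AEMeasurable a (volume.restrict (QQ N T)))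
    (hai : Integrable (fun q => (a q + 1) ^ (α + 1)) (volume.restrict (QQ N T))) :
    Integrable (fun q => Fint f q.1 (a q)) (volume.restrict (QQ N T)) := by
  have hcont : ContinuousOn (fun x => f x 0) (cube N) :=
    hf.comp (f := fun x : RN N => (x, (0 : ℝ))) (by fun_prop)
      fun x _ => ⟨trivial, self_mem_Ici⟩
  obtain ⟨M, hM⟩ := isCompact_Icc.exists_bound_of_continuousOn hcont
  have hQ : MeasurableSet (QQ N T) := measurableSet_Icc.prod measurableSet_Ioo
  refine (hai.const_mul (M + c / α)).mono' (AEMeasurable.aestronglyMeasurable ?_) ?_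
  · have h := (continuous_extended_primitive hf).measurable.comp_aemeasurable
      (measurable_fst.aemeasurable.prodMk ham)
    refine h.congr (ae_of_all _ fun q => ?_)
    exact (Fint_eq_extended f q.1 (ha q)).symm
  · filter_upwards [ae_restrict_mem hQ] with q hq
    exact abs_Fint_le hα (hnn q.1) (hder q.1) (hb q.1)
      ((le_abs_self _).trans (hM q.1 hq.1)) (ha q)

/-- **Lemma 3.4**: the convexified energy `Ē = E + ∫ G` is convex on `K`, and strictly
convex with respect to `m` in a quantitative sense. -/
theorem convexified_energy_convex (N : ℕ) (hN : 1 ≤ N) (T : ℝ) (hT : 0 < T)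
    (γ γ' C_H C_L c_f α : ℝ)
    (H : RN N → ℝ) (f f' : RN N → ℝ → ℝ) (m₀ uT : RN N → ℝ)
    (hγ : 1 < γ) (hγ' : γ' = γ / (γ - 1))
    (hCH : 0 < C_H) (hHconv : ConvexOn ℝ Set.univ H) (hHreg : ContDiff ℝ 3 H)
    (hHgrowth : ∀ p, C_H⁻¹ * euclNorm p ^ γ ≤ H p ∧ H p ≤ C_H * (euclNorm p ^ γ + 1))
    (hCL : 0 < C_L)
    (hLgrowth : ∀ q, C_L⁻¹ * euclNorm q ^ γ' - C_L ≤ Leg H q ∧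
      Leg H q ≤ C_L * (euclNorm q ^ γ' + 1))
    (hα : 0 < α) (hcf : 0 < c_f)
    (hfcont : ContinuousOn (fun q : RN N × ℝ => f q.1 q.2)
      ((Set.univ : Set (RN N)) ×ˢ Ici (0:ℝ)))
    (hfper : ∀ s, ZPeriodic fun x => f x s)
    (hfnn : ∀ x s, 0 ≤ s → 0 ≤ f x s)
    (hfder : ∀ x s, 0 ≤ s → HasDerivAt (f x) (f' x s) s)
    (hfb : ∀ x s, 0 ≤ s → |f' x s| ≤ c_f * (s + 1) ^ (α - 1))
    (hm₀reg : ContDiff ℝ 2 m₀) (hm₀per : ZPeriodic m₀) (hm₀pos : ∀ x, 0 < m₀ x)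
    (hm₀int : (∫ x in cube N, m₀ x) = 1)
    (huTreg : ContDiff ℝ 2 uT) (huTper : ZPeriodic uT)
    (mbar : RN N → ℝ → ℝ) (hmbar0 : ∀ x t, 0 ≤ mbar x t)
    (hmbarLp : IntegrableOn (fun q : RN N × ℝ => mbar q.1 q.2 ^ (α + 1)) (QQ N T)) :
    ∀ τ ∈ Icc (0:ℝ) 1, ∀ m w μ v, MemK N T α γ' m₀ m w → MemK N T α γ' m₀ μ v →
      (energyF N T (Leg H) (Fint f) uT (fun x t => τ * m x t + (1 - τ) * μ x t)
          (fun x t => τ • w x t + (1 - τ) • v x t)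
        + intQ N T (fun x t => Gcvx c_f α (mbar x t) (τ * m x t + (1 - τ) * μ x t)))
      ≤ τ * (energyF N T (Leg H) (Fint f) uT m w
            + intQ N T (fun x t => Gcvx c_f α (mbar x t) (m x t)))
        + (1 - τ) * (energyF N T (Leg H) (Fint f) uT μ v
            + intQ N T (fun x t => Gcvx c_f α (mbar x t) (μ x t)))
        - (1/2) * τ * (1 - τ) * intQ N T (fun x t =>
            min ((m x t + 1) ^ (α - 1)) ((μ x t + 1) ^ (α - 1)) * (m x t - μ x t) ^ 2) := by
  intro τ hτ m w μ v hm hμ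
  have hτ0 := hτ.1
  have hτ1 : 0 ≤ 1 - τ := by linarith [hτ.2]
  set ν := (volume.restrict (QQ N T) : Measure (RN N × ℝ)) with hν
  have hfin : IsFiniteMeasure ν := by
    refine isFiniteMeasure_restrict.2 (ne_of_lt ?_)
    refine (measure_mono (Set.prod_mono subset_rfl Ioo_subset_Icc_self)).trans_lt
      (isCompact_Icc.prod isCompact_Icc).measure_lt_top
  have hconvL : ConvexOn ℝ Set.univ (Leg H) :=
    convexOn_legendre (bddAbove_legendre hγ hCH fun p => (hHgrowth p).1)
  have hLm : Measurable (Leg H) :=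
    (continuousOn_univ.1 (hconvL.continuousOn isOpen_univ)).measurable
  have hLlo : ∀ q, -C_L ≤ Leg H q := fun q => by
    have := Real.rpow_nonneg (euclNorm_nonneg q) γ'
    have : 0 ≤ C_L⁻¹ * euclNorm q ^ γ' := by positivity
    linarith [(hLgrowth q).1]
  have hLup := fun q => (hLgrowth q).2
  set a : RN N × ℝ → ℝ := fun q => m q.1 q.2 with ha
  set b : RN N × ℝ → ℝ := fun q => μ q.1 q.2 with hb
  set e : RN N × ℝ → ℝ := fun q => τ * a q + (1 - τ) * b q with he
  set d : RN N × ℝ → ℝ := fun q => mbar q.1 q.2 with hd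
  set W : RN N × ℝ → RN N := fun q => w q.1 q.2 with hW
  set V : RN N × ℝ → RN N := fun q => v q.1 q.2 with hV
  have ha0 : ∀ q, 0 ≤ a q := fun q => hm.nonneg _ _
  have hb0 : ∀ q, 0 ≤ b q := fun q => hμ.nonneg _ _
  have he0 : ∀ q, 0 ≤ e q := fun q =>
    add_nonneg (mul_nonneg hτ0 (ha0 q)) (mul_nonneg hτ1 (hb0 q))
  have hd0 : ∀ q, 0 ≤ d q := fun q => hmbar0 _ _
  have ham : AEMeasurable a ν := aemeasurable_of_integrable_rpow hα ha0 hm.lp_m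
  have hbm : AEMeasurable b ν := aemeasurable_of_integrable_rpow hα hb0 hμ.lp_m
  have hdm : AEMeasurable d ν := aemeasurable_of_integrable_rpow hα hd0 hmbarLp
  have hem : AEMeasurable e ν := (ham.const_mul τ).add (hbm.const_mul (1 - τ))
  have hai := integrable_add_one_rpow hα ha0 hm.lp_m
  have hbi := integrable_add_one_rpow hα hb0 hμ.lp_m
  have hdi := integrable_add_one_rpow hα hd0 hmbarLp
  have hei := integrable_convexComb_add_one_rpow hα ha0 hb0 ham hbm hai hbi hτ
  have hWm : AEMeasurable W ν := hm.l1_w.aestronglyMeasurable.aemeasurable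
  have hVm : AEMeasurable V ν := hμ.l1_w.aestronglyMeasurable.aemeasurable
  have hLa := integrable_mLag hLm hLlo hLup hCL.le ha0
    (integrable_of_add_one_rpow hα ha0 ham hai) hWm hm.kin_int
  have hLb := integrable_mLag hLm hLlo hLup hCL.le hb0
    (integrable_of_add_one_rpow hα hb0 hbm hbi) hVm hμ.kin_int
  have hLconv : ∀ᵐ q ∂ν, mLag (Leg H) (e q) (τ • W q + (1 - τ) • V q)
      ≤ τ * mLag (Leg H) (a q) (W q) + (1 - τ) * mLag (Leg H) (b q) (V q) := by
    filter_upwards [hm.vanish, hμ.vanish] with q h1 h2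
    exact mLag_convex hconvL (ha0 q) (hb0 q) h1 h2 hτ0 hτ1
  have hLe : Integrable (fun q => mLag (Leg H) (e q) (τ • W q + (1 - τ) • V q)) ν := by
    refine integrable_of_le_of_le ((measurable_mLag hLm).comp_aemeasurable
      (hem.prodMk ((hWm.const_smul τ).add (hVm.const_smul (1 - τ))))).aestronglyMeasurable
      (ae_of_all _ fun q => neg_mul_le_mLag hLlo (he0 q) _) hLconv
      ((integrable_of_add_one_rpow hα he0 hem hei).const_mul C_L).neg
      ((hLa.const_mul τ).add (hLb.const_mul (1 - τ)))
  have hFa : Integrable (fun q => Fint f q.1 (a q)) ν :=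
    integrable_Fint hα hfcont hfnn hfder hfb ha0 ham hai
  have hFb : Integrable (fun q => Fint f q.1 (b q)) ν :=
    integrable_Fint hα hfcont hfnn hfder hfb hb0 hbm hbi
  have hFe : Integrable (fun q => Fint f q.1 (e q)) ν :=
    integrable_Fint hα hfcont hfnn hfder hfb he0 hem hei
  have hGa := integrable_Gcvx hcf.le hα ha0 hd0 ham hdm hai hdi
  have hGb := integrable_Gcvx hcf.le hα hb0 hd0 hbm hdm hbi hdi
  have hGe := integrable_Gcvx hcf.le hα he0 hd0 hem hdm hei hdi
  have hD := integrable_min_rpow_mul_sq ha0 hb0 ham hbm hai hbi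
  have htrace : (∫ x in cube N, uT x * (τ * m x T + (1 - τ) * μ x T))
      = τ * (∫ x in cube N, uT x * m x T) + (1 - τ) * ∫ x in cube N, uT x * μ x T := by
    have hcube : IsCompact (cube N) := isCompact_Icc
    have h1 : IntegrableOn (fun x => uT x * m x T) (cube N) :=
      hm.traceInt.continuousOn_mul huTreg.continuous.continuousOn hcube
    have h2 : IntegrableOn (fun x => uT x * μ x T) (cube N) :=
      hμ.traceInt.continuousOn_mul huTreg.continuous.continuousOn hcube
    rw [← integral_const_mul, ← integral_const_mul,
      ← integral_add (h1.const_mul τ) (h2.const_mul (1 - τ))]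
    congr 1
    ext x
    ring
  have key : (∫ q, (mLag (Leg H) (e q) (τ • W q + (1 - τ) • V q) - Fint f q.1 (e q)) ∂ν)
        + ∫ q, Gcvx c_f α (d q) (e q) ∂ν
      ≤ τ * ((∫ q, (mLag (Leg H) (a q) (W q) - Fint f q.1 (a q)) ∂ν)
          + ∫ q, Gcvx c_f α (d q) (a q) ∂ν)
        + (1 - τ) * ((∫ q, (mLag (Leg H) (b q) (V q) - Fint f q.1 (b q)) ∂ν)
          + ∫ q, Gcvx c_f α (d q) (b q) ∂ν)
        - (1 / 2) * τ * (1 - τ) * ∫ q, min ((a q + 1) ^ (α - 1)) ((b q + 1) ^ (α - 1))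
          * (a q - b q) ^ 2 ∂ν := by
    refine integral_add_le_of_ae_convex (hLa.sub hFa) hGa (hLb.sub hFb) hGb (hLe.sub hFe) hGe
      hD ?_
    filter_upwards [hLconv] with q hq
    have := Gcvx_sub_Fint_convex (mb := d q) hα (hfder q.1) (hfb q.1) (ha0 q) (hb0 q) hτ
    linarith
  simp only [energyF, intQ]
  rw [htrace]
  linarith [key]
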